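/- arXiv:math/0611316 — 6 statements merged into one kernel-verified Lean document; each statement's English description precedes it below -/
import Mathlib

section
/- Let L > 0, a = 2π/L, let h : [0,1] → ℝ be C², θ : [0,1] → ℝ be C¹, and H : [0,1] → ℝ be C¹ with H(0) = H(1) = 0. Define the advecting velocity field U(x₁,x₂) = (cos(2a x₁) H'(x₂), 2a sin(2a x₁) H(x₂)), the advected velocity field v(x₁,x₂) = (−sin(a x₁) h'(x₂), a cos(a x₁) h(x₂)) with temperature T₂(x₁,x₂) = cos(a x₁) θ(x₂), and the test velocity field w(x₁,x₂) = (cos(a x₁) h'(x₂), a sin(a x₁) h(x₂)) with temperature T₃(x₁,x₂) = sin(a x₁) θ(x₂). Then the trilinear interaction integral vanishes: ∫₀^L ∫₀¹ [ ((U·∇)v)(x₁,x₂) · w(x₁,x₂) + (U·∇T₂)(x₁,x₂) · T₃(x₁,x₂) ] dx₂ dx₁ = 0. -/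
open Real

/-- Partial derivative in the first variable. -/
noncomputable def pd1 (f : ℝ → ℝ → ℝ) (x y : ℝ) : ℝ := deriv (fun s => f s y) x

/-- Partial derivative in the second variable. -/
noncomputable def pd2 (f : ℝ → ℝ → ℝ) (x y : ℝ) : ℝ := deriv (fun t => f x t) y

/-- `cos (2πn x / L)` integrates to zero over `[0, L]` for a nonzero integer `n`. -/
theorem integral_cos_mul_period {L : ℝ} (hL : 0 < L) {n : ℤ} (hn : n ≠ 0) :
    ∫ x in (0:ℝ)..L, cos (n * (2 * π / L) * x) = 0 := by
  have hn' : (n : ℝ) ≠ 0 := Int.cast_ne_zero.mpr hn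
  have hc : (n : ℝ) * (2 * π / L) ≠ 0 := by positivity
  rw [intervalIntegral.integral_comp_mul_left cos hc, integral_cos]
  have hper : (n : ℝ) * (2 * π / L) * L = ((2 * n : ℤ) : ℝ) * π := by
    push_cast
    field_simp
  rw [hper, sin_int_mul_pi]
  simp

/-- The trilinear interaction integral
`∫₀^L ∫₀¹ [ ((U·∇)v)·w + (U·∇T₂) T₃ ] dx₂ dx₁` vanishes for the explicit Fourier
eigenmodes `U = ψ̃₂ⱼ`-velocity, `(v, T₂) = ψ₁₁`, `(w, T₃) = ψ̃₁₁` with `H 0 = H 1 = 0`. -/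
theorem trilinear_interaction_vanishes
    (L : ℝ) (hL : 0 < L) (a : ℝ) (ha : a = 2 * π / L)
    (h θ H : ℝ → ℝ)
    (hh : ContDiff ℝ 2 h) (hθ : ContDiff ℝ 1 θ) (hH : ContDiff ℝ 1 H)
    (hH0 : H 0 = 0) (hH1 : H 1 = 0)
    (U₁ U₂ v₁ v₂ T₂ w₁ w₂ T₃ : ℝ → ℝ → ℝ)
    (hU₁ : ∀ x y : ℝ, U₁ x y = cos (2 * a * x) * deriv H y)
    (hU₂ : ∀ x y : ℝ, U₂ x y = 2 * a * sin (2 * a * x) * H y)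
    (hv₁ : ∀ x y : ℝ, v₁ x y = -sin (a * x) * deriv h y)
    (hv₂ : ∀ x y : ℝ, v₂ x y = a * cos (a * x) * h y)
    (hT₂ : ∀ x y : ℝ, T₂ x y = cos (a * x) * θ y)
    (hw₁ : ∀ x y : ℝ, w₁ x y = cos (a * x) * deriv h y)
    (hw₂ : ∀ x y : ℝ, w₂ x y = a * sin (a * x) * h y)
    (hT₃ : ∀ x y : ℝ, T₃ x y = sin (a * x) * θ y) :
    ∫ x in (0:ℝ)..L, ∫ y in (0:ℝ)..1,
        ((U₁ x y * pd1 v₁ x y + U₂ x y * pd2 v₁ x y) * w₁ x y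
          + (U₁ x y * pd1 v₂ x y + U₂ x y * pd2 v₂ x y) * w₂ x y
          + (U₁ x y * pd1 T₂ x y + U₂ x y * pd2 T₂ x y) * T₃ x y) = 0 := by
  have hh1 : ContDiff ℝ 1 (deriv h) := hh.deriv'
  have dh (y : ℝ) : HasDerivAt h (deriv h y) y :=
    (hh.differentiable (by norm_num) y).hasDerivAt
  have dh1 (y : ℝ) : HasDerivAt (deriv h) (deriv (deriv h) y) y :=
    (hh1.differentiable (by norm_num) y).hasDerivAt
  have dθ (y : ℝ) : HasDerivAt θ (deriv θ y) y :=
    (hθ.differentiable (by norm_num) y).hasDerivAt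
  have dH (y : ℝ) : HasDerivAt H (deriv H y) y :=
    (hH.differentiable (by norm_num) y).hasDerivAt
  have ch := hh.continuous
  have ch1 := hh1.continuous
  have ch2 := hh1.continuous_deriv le_rfl
  have cθ := hθ.continuous
  have cθ1 := hθ.continuous_deriv le_rfl
  have cH := hH.continuous
  have cH1 := hH.continuous_deriv le_rfl
  have dcos (x : ℝ) : HasDerivAt (fun s => cos (a * s)) (-(a * sin (a * x))) x := by
    convert ((hasDerivAt_id' x).const_mul a).cos using 1
    ring
  have dsin (x : ℝ) : HasDerivAt (fun s => sin (a * s)) (a * cos (a * x)) x := by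
    convert ((hasDerivAt_id' x).const_mul a).sin using 1
    ring
  have p1v₁ (x y : ℝ) : pd1 v₁ x y = -(a * cos (a * x)) * deriv h y := by
    simpa only [pd1, hv₁] using ((dsin x).fun_neg.mul_const (deriv h y)).deriv
  have p2v₁ (x y : ℝ) : pd2 v₁ x y = -sin (a * x) * deriv (deriv h) y := by
    simpa only [pd2, hv₁] using ((dh1 y).const_mul (-sin (a * x))).deriv
  have p1v₂ (x y : ℝ) : pd1 v₂ x y = a * -(a * sin (a * x)) * h y := by
    simpa only [pd1, hv₂] using (((dcos x).const_mul a).mul_const (h y)).deriv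
  have p2v₂ (x y : ℝ) : pd2 v₂ x y = a * cos (a * x) * deriv h y := by
    simpa only [pd2, hv₂] using ((dh y).const_mul (a * cos (a * x))).deriv
  have p1T₂ (x y : ℝ) : pd1 T₂ x y = -(a * sin (a * x)) * θ y := by
    simpa only [pd1, hT₂] using ((dcos x).mul_const (θ y)).deriv
  have p2T₂ (x y : ℝ) : pd2 T₂ x y = cos (a * x) * deriv θ y := by
    simpa only [pd2, hT₂] using ((dθ y).const_mul (cos (a * x))).deriv
  -- The `x`-mean of the integrand is proportional to the derivative of `G`.
  let G : ℝ → ℝ := fun y => H y * (a ^ 2 * h y ^ 2 + θ y ^ 2 - deriv h y ^ 2)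
  let G' : ℝ → ℝ := fun y => deriv H y * (a ^ 2 * h y ^ 2 + θ y ^ 2 - deriv h y ^ 2)
    + H y * (2 * a ^ 2 * h y * deriv h y + 2 * θ y * deriv θ y
      - 2 * deriv h y * deriv (deriv h) y)
  have dG (y : ℝ) : HasDerivAt G (G' y) y := by
    refine ((dH y).mul (((((dh y).pow 2).const_mul (a ^ 2)).add ((dθ y).pow 2)).sub
      ((dh1 y).pow 2))).congr_deriv ?_
    simp only [G', Pi.add_apply, Pi.sub_apply, Pi.pow_apply]
    push_cast
    ring
  have cG' : Continuous G' := by fun_prop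
  have hG : ∫ y in (0:ℝ)..1, G' y = 0 := by
    rw [intervalIntegral.integral_eq_sub_of_hasDerivAt (fun y _ => dG y)
      (cG'.intervalIntegrable 0 1)]
    simp [G, hH0, hH1]
  let R : ℝ → ℝ := fun y => -(a / 2) * deriv H y * (a ^ 2 * h y ^ 2 + θ y ^ 2 + deriv h y ^ 2)
  let P : ℝ → ℝ := fun y => a / 2 * deriv H y * (a ^ 2 * h y ^ 2 + θ y ^ 2 - deriv h y ^ 2)
  have cR : Continuous R := by fun_prop
  have cP : Continuous P := by fun_prop
  have integrand_eq (x y : ℝ) :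
      (U₁ x y * pd1 v₁ x y + U₂ x y * pd2 v₁ x y) * w₁ x y
          + (U₁ x y * pd1 v₂ x y + U₂ x y * pd2 v₂ x y) * w₂ x y
          + (U₁ x y * pd1 T₂ x y + U₂ x y * pd2 T₂ x y) * T₃ x y
        = cos (2 * a * x) * R y + cos (4 * a * x) * P y
          + a / 2 * sin (2 * a * x) ^ 2 * G' y := by
    rw [hU₁, hU₂, hw₁, hw₂, hT₃, p1v₁, p2v₁, p1v₂, p2v₂, p1T₂, p2T₂,
      show 4 * a * x = 2 * (2 * (a * x)) by ring, show 2 * a * x = 2 * (a * x) by ring,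
      cos_two_mul (2 * (a * x)), sin_two_mul, cos_two_mul]
    simp only [R, P, G']
    have hs : sin (a * x) ^ 2 = 1 - cos (a * x) ^ 2 := sin_sq _
    generalize sin (a * x) = s at *
    generalize cos (a * x) = c at *
    ring_nf
    simp only [hs]
    ring
  have inner_eq (x : ℝ) :
      ∫ y in (0:ℝ)..1, (cos (2 * a * x) * R y + cos (4 * a * x) * P y
          + a / 2 * sin (2 * a * x) ^ 2 * G' y)
        = cos (2 * a * x) * (∫ y in (0:ℝ)..1, R y)
          + cos (4 * a * x) * ∫ y in (0:ℝ)..1, P y := by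
    have iR := (cR.const_mul (cos (2 * a * x))).intervalIntegrable
      (μ := MeasureTheory.volume) 0 1
    have iP := (cP.const_mul (cos (4 * a * x))).intervalIntegrable
      (μ := MeasureTheory.volume) 0 1
    have iG := (cG'.const_mul (a / 2 * sin (2 * a * x) ^ 2)).intervalIntegrable
      (μ := MeasureTheory.volume) 0 1
    rw [intervalIntegral.integral_add (iR.add iP) iG, intervalIntegral.integral_add iR iP]
    simp only [intervalIntegral.integral_const_mul, hG, mul_zero, add_zero]
  have hcos2 : ∫ x in (0:ℝ)..L, cos (2 * a * x) = 0 := by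
    simpa [ha] using integral_cos_mul_period hL (n := 2) (by norm_num)
  have hcos4 : ∫ x in (0:ℝ)..L, cos (4 * a * x) = 0 := by
    simpa [ha] using integral_cos_mul_period hL (n := 4) (by norm_num)
  simp only [integrand_eq, inner_eq]
  rw [intervalIntegral.integral_add
    (Continuous.intervalIntegrable (by fun_prop) _ _)
    (Continuous.intervalIntegrable (by fun_prop) _ _)]
  simp only [intervalIntegral.integral_mul_const, hcos2, hcos4, zero_mul, add_zero]
end

section
/- Let L > 0, a = 2π/L, let h : [0,1] → ℝ be C², θ : [0,1] → ℝ be C¹, and let H, Θ : [0,1] → ℝ be continuous. Define (u,T) by u = (−sin(a x₁) h'(x₂), a cos(a x₁) h(x₂)), T = cos(a x₁) θ(x₂); define (ũ,T̃) by ũ = (cos(a x₁) h'(x₂), a sin(a x₁) h(x₂)), T̃ = sin(a x₁) θ(x₂); and define the test mode (w,Θ̂) by w = (−sin(2a x₁) H'(x₂), 2a cos(2a x₁) H(x₂)) with H C¹, Θ̂(x₁,x₂) = cos(2a x₁) Θ(x₂). Then ∫₀^L ∫₀¹ [ ((u·∇)u)·w + (u·∇T)·Θ̂ ] dx₂ dx₁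 = − ∫₀^L ∫₀¹ [ ((ũ·∇)ũ)·w + (ũ·∇T̃)·Θ̂ ] dx₂ dx₁. -/
open Real

theorem pd1_eq_mul_shift {f g : ℝ → ℝ → ℝ} {c s : ℝ} (hfg : ∀ x y, f x y = c * g (x + s) y)
    (x y : ℝ) : pd1 f x y = c * pd1 g (x + s) y := by
  simp only [pd1, hfg, deriv_const_mul_field']
  rw [deriv_comp_add_const (fun t => g t y) s x]

theorem pd2_eq_mul_shift {f g : ℝ → ℝ → ℝ} {c s : ℝ} (hfg : ∀ x y, f x y = c * g (x + s) y)
    (x y : ℝ) : pd2 f x y = c * pd2 g (x + s) y := by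
  simp only [pd2, hfg, deriv_const_mul_field']

/-- The density `((u·∇)u)·w + (u·∇T) Θ̂` of the projection. -/
noncomputable def projectionDensity (u₁ u₂ T w₁ w₂ Θh : ℝ → ℝ → ℝ) (x y : ℝ) : ℝ :=
  (u₁ x y * pd1 u₁ x y + u₂ x y * pd2 u₁ x y) * w₁ x y
    + (u₁ x y * pd1 u₂ x y + u₂ x y * pd2 u₂ x y) * w₂ x y
    + (u₁ x y * pd1 T x y + u₂ x y * pd2 T x y) * Θh x y

/-- Shifting by `s` and scaling the mode by `c` and the test mode by `d`
scales the density by `c ^ 2 * d`. -/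
theorem projectionDensity_eq_mul_shift {u₁ u₂ T w₁ w₂ Θh v₁ v₂ S z₁ z₂ Φ : ℝ → ℝ → ℝ} {c d s : ℝ}
    (h₁ : ∀ x y, v₁ x y = c * u₁ (x + s) y) (h₂ : ∀ x y, v₂ x y = c * u₂ (x + s) y)
    (hS : ∀ x y, S x y = c * T (x + s) y) (hz₁ : ∀ x y, z₁ x y = d * w₁ (x + s) y)
    (hz₂ : ∀ x y, z₂ x y = d * w₂ (x + s) y) (hΦ : ∀ x y, Φ x y = d * Θh (x + s) y) (x y : ℝ) :
    projectionDensity v₁ v₂ S z₁ z₂ Φ x y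
      = c ^ 2 * d * projectionDensity u₁ u₂ T w₁ w₂ Θh (x + s) y := by
  simp only [projectionDensity, pd1_eq_mul_shift h₁, pd1_eq_mul_shift h₂, pd1_eq_mul_shift hS,
    pd2_eq_mul_shift h₁, pd2_eq_mul_shift h₂, pd2_eq_mul_shift hS, h₁, h₂, hz₁, hz₂, hΦ]
  ring

/-- The projections of the quadratic self-interactions of the two first eigenmodes
`ψ₁₁ = (u, T)` and `ψ̃₁₁ = (ũ, T̃)` onto the second-wavenumber eigenmode `ψ₂ⱼ = (w, Θ̂)`
are opposite to each other. -/
theorem second_mode_projections_opposite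
    (L : ℝ) (hL : 0 < L) (a : ℝ) (ha : a = 2 * π / L)
    (h θ H Θ : ℝ → ℝ)
    (hh : ContDiff ℝ 2 h) (hθ : ContDiff ℝ 1 θ) (hH : ContDiff ℝ 1 H) (hΘ : Continuous Θ)
    (u₁ u₂ T ut₁ ut₂ Tt w₁ w₂ Θh : ℝ → ℝ → ℝ)
    (hu₁ : ∀ x y : ℝ, u₁ x y = -sin (a * x) * deriv h y)
    (hu₂ : ∀ x y : ℝ, u₂ x y = a * cos (a * x) * h y)
    (hT : ∀ x y : ℝ, T x y = cos (a * x) * θ y)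
    (hut₁ : ∀ x y : ℝ, ut₁ x y = cos (a * x) * deriv h y)
    (hut₂ : ∀ x y : ℝ, ut₂ x y = a * sin (a * x) * h y)
    (hTt : ∀ x y : ℝ, Tt x y = sin (a * x) * θ y)
    (hw₁ : ∀ x y : ℝ, w₁ x y = -sin (2 * a * x) * deriv H y)
    (hw₂ : ∀ x y : ℝ, w₂ x y = 2 * a * cos (2 * a * x) * H y)
    (hΘh : ∀ x y : ℝ, Θh x y = cos (2 * a * x) * Θ y) :
    (∫ x in (0:ℝ)..L, ∫ y in (0:ℝ)..1,
        ((u₁ x y * pd1 u₁ x y + u₂ x y * pd2 u₁ x y) * w₁ x y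
          + (u₁ x y * pd1 u₂ x y + u₂ x y * pd2 u₂ x y) * w₂ x y
          + (u₁ x y * pd1 T x y + u₂ x y * pd2 T x y) * Θh x y))
      = -∫ x in (0:ℝ)..L, ∫ y in (0:ℝ)..1,
        ((ut₁ x y * pd1 ut₁ x y + ut₂ x y * pd2 ut₁ x y) * w₁ x y
          + (ut₁ x y * pd1 ut₂ x y + ut₂ x y * pd2 ut₂ x y) * w₂ x y
          + (ut₁ x y * pd1 Tt x y + ut₂ x y * pd2 Tt x y) * Θh x y) := by
  have hL0 : L ≠ 0 := hL.ne'
  have quarter (x : ℝ) : a * (x + L / 4) = a * x + π / 2 := by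
    rw [ha]; field_simp; ring
  have quarter_two (x : ℝ) : 2 * a * (x + L / 4) = 2 * a * x + π := by
    rw [ha]; field_simp; ring
  have period (x : ℝ) : a * (x + L) = a * x + 2 * π := by
    rw [ha]; field_simp
  have period_two (x : ℝ) : 2 * a * (x + L) = 2 * a * x + 2 * π + 2 * π := by
    rw [ha]; field_simp; ring
  have hshift : ∀ x y, projectionDensity ut₁ ut₂ Tt w₁ w₂ Θh x y
      = (-1) ^ 2 * (-1) * projectionDensity u₁ u₂ T w₁ w₂ Θh (x + L / 4) y := by
    apply projectionDensity_eq_mul_shift <;> intro x y <;>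
      simp only [hu₁, hu₂, hT, hut₁, hut₂, hTt, hw₁, hw₂, hΘh, quarter, quarter_two,
        sin_add_pi_div_two, cos_add_pi_div_two, sin_add_pi, cos_add_pi] <;> ring
  have hperiod : ∀ x y, projectionDensity u₁ u₂ T w₁ w₂ Θh x y
      = 1 ^ 2 * 1 * projectionDensity u₁ u₂ T w₁ w₂ Θh (x + L) y := by
    apply projectionDensity_eq_mul_shift <;> intro x y <;>
      simp only [hu₁, hu₂, hT, hw₁, hw₂, hΘh, period, period_two,
        sin_add_two_pi, cos_add_two_pi] <;> ring
  set G : ℝ → ℝ := fun x => ∫ y in (0:ℝ)..1, projectionDensity u₁ u₂ T w₁ w₂ Θh x y with hG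
  have hGper : Function.Periodic G L := fun x => by
    simp [hG, hperiod x]
  change (∫ x in (0:ℝ)..L, G x)
    = -∫ x in (0:ℝ)..L, ∫ y in (0:ℝ)..1, projectionDensity ut₁ ut₂ Tt w₁ w₂ Θh x y
  have hGt (x : ℝ) : (∫ y in (0:ℝ)..1, projectionDensity ut₁ ut₂ Tt w₁ w₂ Θh x y)
      = -G (x + L / 4) := by
    simp [hG, hshift x]
  simp only [hGt, intervalIntegral.integral_neg, neg_neg]
  rw [intervalIntegral.integral_comp_add_right G (L / 4), zero_add, add_comm L]
  simpa using hGper.intervalIntegral_add_eq 0 (L / 4)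
end

section
/- Let L > 0, a = 2π/L, r ≠ 0, let h : [0,1] → ℝ be C³, and define e₀(x₁,x₂) = (r cos(a x₁) h'(x₂), a r sin(a x₁) h(x₂)). Let b ∈ {0,1} with h'(b) = 0. Then at any point p = ((2k+1)L/4, b) with k an integer, the determinant det [[∂²e₀¹/∂x₁∂x₂ (p), ∂²e₀¹/∂x₂² (p)], [∂²e₀²/∂x₁∂x₂ (p), ∂²e₀²/∂x₂² (p)]] equals −a² r² h''(b)²; consequently this determinant is nonzero if and only if h''(b) ≠ 0, i.e. the boundary singular points ((2k+1)L/4, b) of e₀ are non-degenerate ∂-singular points whenever h''(b) ≠ 0. -/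
open Real

/-- At the boundary points `((2k+1)L/4, b)` with `b ∈ {0,1}` and `h'(b) = 0`, the
determinant of the matrix of second partial derivatives of
`e₀ = (r cos(ax₁) h'(x₂), a r sin(ax₁) h(x₂))` equals `-a²r² h''(b)²`; hence these
`∂`-singular points are non-degenerate if and only if `h''(b) ≠ 0`. -/
theorem boundary_singular_points_nondegenerate
    (L : ℝ) (hL : 0 < L) (a : ℝ) (ha : a = 2 * π / L) (r : ℝ) (hr : r ≠ 0)
    (h : ℝ → ℝ) (hh : ContDiff ℝ 3 h)
    (e₁ e₂ : ℝ → ℝ → ℝ)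
    (he₁ : ∀ x y : ℝ, e₁ x y = r * cos (a * x) * deriv h y)
    (he₂ : ∀ x y : ℝ, e₂ x y = a * r * sin (a * x) * h y)
    (b : ℝ) (hb : b = 0 ∨ b = 1) (hb' : deriv h b = 0)
    (k : ℤ) (p₁ : ℝ) (hp₁ : p₁ = (2 * k + 1) * L / 4) :
    (deriv (fun x => deriv (fun y => e₁ x y) b) p₁
        * deriv (fun y => deriv (fun t => e₂ p₁ t) y) b
      - deriv (fun y => deriv (fun t => e₁ p₁ t) y) b
        * deriv (fun x => deriv (fun y => e₂ x y) b) p₁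
      = -a ^ 2 * r ^ 2 * (deriv (deriv h) b) ^ 2) ∧
    ((deriv (fun x => deriv (fun y => e₁ x y) b) p₁
        * deriv (fun y => deriv (fun t => e₂ p₁ t) y) b
      - deriv (fun y => deriv (fun t => e₁ p₁ t) y) b
        * deriv (fun x => deriv (fun y => e₂ x y) b) p₁ ≠ 0)
      ↔ deriv (deriv h) b ≠ 0) := by
  have hap : a * p₁ = (2 * k + 1) * π / 2 := by
    rw [ha, hp₁]
    field_simp
    ring
  have hcos : cos (a * p₁) = 0 := cos_eq_zero_iff.mpr ⟨k, hap⟩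
  have hsin : sin (a * p₁) ^ 2 = 1 := by
    have := sin_sq_add_cos_sq (a * p₁)
    rw [hcos] at this
    linarith
  have ha0 : a ≠ 0 := by
    rw [ha]
    positivity
  have h₁xy : deriv (fun x => deriv (fun y => e₁ x y) b) p₁
      = -(a * r * sin (a * p₁) * deriv (deriv h) b) := by
    simp only [he₁, deriv_const_mul_field]
    have hd : HasDerivAt (fun x => r * cos (a * x) * deriv (deriv h) b)
        (r * (-sin (a * p₁) * (a * 1)) * deriv (deriv h) b) p₁ :=
      ((((hasDerivAt_id' p₁).const_mul a).cos).const_mul r).mul_const _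
    rw [hd.deriv]
    ring
  have h₂yy : deriv (fun y => deriv (fun t => e₂ p₁ t) y) b
      = a * r * sin (a * p₁) * deriv (deriv h) b := by
    simp only [he₂, deriv_const_mul_field]
  have h₁yy : deriv (fun y => deriv (fun t => e₁ p₁ t) y) b = 0 := by
    simp [he₁, hcos]
  have hdet : deriv (fun x => deriv (fun y => e₁ x y) b) p₁
        * deriv (fun y => deriv (fun t => e₂ p₁ t) y) b
      - deriv (fun y => deriv (fun t => e₁ p₁ t) y) b
        * deriv (fun x => deriv (fun y => e₂ x y) b) p₁
      = -a ^ 2 * r ^ 2 * (deriv (deriv h) b) ^ 2 := by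
    rw [h₁xy, h₂yy, h₁yy]
    linear_combination (-a ^ 2 * r ^ 2 * (deriv (deriv h) b) ^ 2) * hsin
  refine ⟨hdet, ?_⟩
  rw [hdet]
  simp [ha0, hr]
end

section
/- Let α > 0 and β > 0, and let f : [0,∞) → ℝ² be differentiable with f'(t) = β f(t) − α ‖f(t)‖² f(t) for all t ≥ 0 and f(0) ≠ 0. Then ‖f(t)‖² → β/α as t → ∞; that is, every solution with nonzero initial value converges to the bifurcated circle ‖x‖² = β/α. -/
open Filter

/-- Closed form of the solution of the logistic equation `s' = 2s(β - αs)` with `s ≥ 0`. -/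
lemma logistic_closed_form {α β : ℝ} (hα : 0 ≤ α) {s : ℝ → ℝ}
    (hs_nonneg : ∀ t, 0 ≤ s t)
    (hs : ∀ t : ℝ, 0 ≤ t → HasDerivAt s (2 * s t * (β - α * s t)) t) {t : ℝ} (ht : 0 ≤ t) :
    s t * (α * s 0 + (β - α * s 0) * Real.exp (-(2 * β) * t)) = β * s 0 := by
  set c : ℝ → ℝ := fun t => α * s 0 + (β - α * s 0) * Real.exp (-(2 * β) * t) with hc
  set D : ℝ → ℝ := fun t => s t * c t - β * s 0 with hD
  have hcd (t : ℝ) : HasDerivAt c (-(2 * β) * (c t - α * s 0)) t := by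
    have h := ((((hasDerivAt_id t).const_mul (-(2 * β))).exp).const_mul
      (β - α * s 0)).const_add (α * s 0)
    refine h.congr_deriv ?_
    simp only [hc, id]
    ring
  have hDd (t : ℝ) (ht : 0 ≤ t) : HasDerivAt D (-(2 * α * s t) * D t) t := by
    refine (((hs t ht).mul (hcd t)).sub_const (β * s 0)).congr_deriv ?_
    simp only [hD]
    ring
  have hDsq (t : ℝ) (ht : 0 ≤ t) :
      HasDerivAt (fun t => D t ^ 2) (-(4 * α * s t * D t ^ 2)) t := by
    refine ((hDd t ht).pow 2).congr_deriv ?_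
    push_cast
    ring
  have hanti : AntitoneOn (fun t => D t ^ 2) (Set.Ici 0) := by
    refine antitoneOn_of_deriv_nonpos (convex_Ici 0)
      (fun t ht => (hDsq t ht).continuousAt.continuousWithinAt)
      (fun t ht => (hDsq t (interior_subset ht)).differentiableAt.differentiableWithinAt)
      (fun t ht => ?_)
    rw [(hDsq t (interior_subset ht)).deriv]
    have := hs_nonneg t
    exact neg_nonpos.mpr (by positivity)
  have hD0 : D 0 = 0 := by
    simp only [hD, hc, mul_zero, Real.exp_zero]
    ring
  have hle : D t ^ 2 ≤ D 0 ^ 2 := hanti Set.self_mem_Ici ht ht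
  rw [hD0] at hle
  have hDt : D t = 0 := pow_eq_zero_iff two_ne_zero |>.mp (by nlinarith [sq_nonneg (D t)])
  exact sub_eq_zero.mp hDt

/-- Nonnegative solutions of `s' = 2s(β - αs)` with `s 0 > 0` converge to `β / α`. -/
lemma logistic_tendsto {α β : ℝ} (hα : 0 < α) (hβ : 0 < β) {s : ℝ → ℝ}
    (hs_nonneg : ∀ t, 0 ≤ s t)
    (hs : ∀ t : ℝ, 0 ≤ t → HasDerivAt s (2 * s t * (β - α * s t)) t) (hs0 : 0 < s 0) :
    Tendsto s atTop (nhds (β / α)) := by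
  have hexp : Tendsto (fun t : ℝ => Real.exp (-(2 * β) * t)) atTop (nhds 0) :=
    Real.tendsto_exp_atBot.comp (tendsto_id.const_mul_atTop_of_neg (by linarith))
  have hc : Tendsto (fun t : ℝ => α * s 0 + (β - α * s 0) * Real.exp (-(2 * β) * t))
      atTop (nhds (α * s 0)) := by
    simpa using (hexp.const_mul (β - α * s 0)).const_add (α * s 0)
  have hαs : 0 < α * s 0 := mul_pos hα hs0
  have hlim := (tendsto_const_nhds (x := β * s 0)).div hc hαs.ne'
  rw [mul_div_mul_right _ _ hs0.ne'] at hlim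
  refine hlim.congr' ?_
  filter_upwards [hc.eventually_ne hαs.ne', eventually_ge_atTop 0] with t hct ht
  exact (eq_div_of_mul_eq hct (logistic_closed_form hα.le hs_nonneg hs ht)).symm

/-- Every solution of the cubic normal form `dx/dt = βx - α‖x‖²x` (`α, β > 0`) with
nonzero initial value converges to the bifurcated circle `‖x‖² = β/α`. -/
theorem normal_form_attractor
    (α β : ℝ) (hα : 0 < α) (hβ : 0 < β)
    (f : ℝ → EuclideanSpace ℝ (Fin 2))
    (hf : ∀ t : ℝ, 0 ≤ t → HasDerivAt f (β • f t - (α * ‖f t‖ ^ 2) • f t) t)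
    (hf0 : f 0 ≠ 0) :
    Tendsto (fun t => ‖f t‖ ^ 2) atTop (nhds (β / α)) := by
  refine logistic_tendsto hα hβ (fun t => by positivity) (fun t ht => ?_)
    (pow_pos (norm_pos_iff.mpr hf0) 2)
  refine (hf t ht).norm_sq.congr_deriv ?_
  rw [inner_sub_right, real_inner_smul_right, real_inner_smul_right, real_inner_self_eq_norm_sq]
  ring
end

section
/- Let α, β ∈ ℝ, and let f : [0,∞) → ℝ² be differentiable with f'(t) = β f(t) − α ‖f(t)‖² f(t) for all t ≥ 0 and f(0) ≠ 0. Then for every t ≥ 0 there exists λ(t) > 0 with f(t) = λ(t) f(0); that is, every solution of the normal-form system remains on the open ray through its initial point, so the flow on the plane minus the origin is purely radial. -/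
/-- A solution on `[0, ∞)` of the linear equation `f' = a f` with continuous scalar coefficient `a`
is the exponential of the integral of `a` times the initial value. -/
theorem eq_exp_integral_smul_of_hasDerivAt {E : Type*} [NormedAddCommGroup E] [NormedSpace ℝ E]
    {a : ℝ → ℝ} {f : ℝ → E} (ha : ContinuousOn a (Set.Ici 0))
    (hf : ∀ t : ℝ, 0 ≤ t → HasDerivAt f (a t • f t) t) {t : ℝ} (ht : 0 ≤ t) :
    f t = Real.exp (∫ s in (0 : ℝ)..t, a (max s 0)) • f 0 := by
  have hc : Continuous fun s : ℝ => a (max s 0) :=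
    ha.comp_continuous (by fun_prop) fun s => le_max_right s 0
  set A : ℝ → ℝ := fun u => ∫ s in (0 : ℝ)..u, a (max s 0) with hA
  have hderiv : ∀ u : ℝ, 0 ≤ u → HasDerivAt (fun v => Real.exp (-A v) • f v) 0 u := by
    intro u hu
    have hAu : HasDerivAt A (a u) u := by
      simpa [max_eq_left hu] using hc.integral_hasStrictDerivAt 0 u |>.hasDerivAt
    convert hAu.fun_neg.exp.fun_smul (hf u hu) using 1
    module
  have hconst := constant_of_has_deriv_right_zero (a := 0) (b := t)
    (fun u hu => (hderiv u hu.1).continuousAt.continuousWithinAt)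
    (fun u hu => (hderiv u hu.1).hasDerivWithinAt) t ⟨ht, le_rfl⟩
  have hA0 : A 0 = 0 := intervalIntegral.integral_same
  simp only [hA0, neg_zero, Real.exp_zero, one_smul] at hconst
  rw [← hconst, smul_smul, ← Real.exp_add, add_neg_cancel, Real.exp_zero, one_smul]


/-- Every solution of the cubic normal form `dx/dt = βx - α‖x‖²x` with nonzero initial
value stays on the open ray through its initial point: the flow is purely radial. -/
theorem normal_form_radial_flow
    (α β : ℝ)
    (f : ℝ → EuclideanSpace ℝ (Fin 2))
    (hf : ∀ t : ℝ, 0 ≤ t → HasDerivAt f (β • f t - (α * ‖f t‖ ^ 2) • f t) t)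
    (hf0 : f 0 ≠ 0) :
    ∀ t : ℝ, 0 ≤ t → ∃ l : ℝ, 0 < l ∧ f t = l • f 0 := by
  intro t ht
  have hcont : ContinuousOn (fun s => β - α * ‖f s‖ ^ 2) (Set.Ici 0) := by
    have hfc : ContinuousOn f (Set.Ici 0) :=
      fun s hs => (hf s hs).continuousAt.continuousWithinAt
    fun_prop
  exact ⟨_, Real.exp_pos _, eq_exp_integral_smul_of_hasDerivAt hcont
    (fun s hs => by simpa only [sub_smul] using hf s hs) ht⟩
end

section
/- Let α ≥ 0 and β ∈ ℝ, and let f : [0,∞) → ℝ² be differentiable with f'(t) = β f(t) − α ‖f(t)‖² f(t) for all t ≥ 0. Then ‖f(t)‖ ≤ e^{βt} ‖f(0)‖ for all t ≥ 0. In particular, if β < 0 then f(t) → 0 as t → ∞, so the trivial equilibrium is globally asymptotically stable below the critical parameter value. -/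
open Filter

/-- Growth estimate for a one-sided dissipative field: if `⟪f, f'⟫ ≤ β‖f‖²` along `f`, then
`‖f t‖ ≤ e^{βt}‖f 0‖` for `t ≥ 0`. -/
theorem norm_le_exp_mul_norm_of_inner_deriv_le {E : Type*} [NormedAddCommGroup E]
    [InnerProductSpace ℝ E] {f f' : ℝ → E} {β : ℝ}
    (hf : ∀ t : ℝ, 0 ≤ t → HasDerivWithinAt f (f' t) (Set.Ici 0) t)
    (hinner : ∀ t : ℝ, 0 ≤ t → inner ℝ (f t) (f' t) ≤ β * ‖f t‖ ^ 2) {t : ℝ} (ht : 0 ≤ t) :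
    ‖f t‖ ≤ Real.exp (β * t) * ‖f 0‖ := by
  have hg (s : ℝ) (hs : 0 ≤ s) : HasDerivWithinAt
      (fun s ↦ Real.exp (-(2 * β) * s) * ‖f s‖ ^ 2)
      (Real.exp (-(2 * β) * s) * (-(2 * β)) * ‖f s‖ ^ 2 +
        Real.exp (-(2 * β) * s) * (2 * inner ℝ (f s) (f' s))) (Set.Ici 0) s := by
    have hexp := ((hasDerivAt_id' s).const_mul (-(2 * β))).exp.hasDerivWithinAt (s := Set.Ici 0)
    rw [mul_one] at hexp
    exact hexp.mul (hf s hs).norm_sq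
  have hanti : AntitoneOn (fun s ↦ Real.exp (-(2 * β) * s) * ‖f s‖ ^ 2) (Set.Ici 0) := by
    refine antitoneOn_of_hasDerivWithinAt_nonpos (convex_Ici 0)
      (fun s hs ↦ (hg s hs).continuousWithinAt)
      (fun s hs ↦ (hg s (interior_subset hs)).mono interior_subset) fun s hs ↦ ?_
    nlinarith [Real.exp_pos (-(2 * β) * s), hinner s (interior_subset hs)]
  have hle : Real.exp (-(2 * β) * t) * ‖f t‖ ^ 2 ≤ ‖f 0‖ ^ 2 := by
    simpa using hanti (Set.mem_Ici.2 le_rfl) ht ht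
  refine le_of_sq_le_sq ?_ (by positivity)
  have hmul := mul_le_mul_of_nonneg_left hle (Real.exp_pos (2 * β * t)).le
  rw [← mul_assoc, ← Real.exp_add, neg_mul, add_neg_cancel, Real.exp_zero, one_mul] at hmul
  rw [mul_pow, ← Real.exp_nat_mul]
  convert hmul using 3
  push_cast
  ring

/-- For the cubic normal form `dx/dt = βx - α‖x‖²x` with `α ≥ 0`, solutions satisfy
`‖f(t)‖ ≤ e^{βt}‖f(0)‖`; in particular if `β < 0` every solution tends to `0`, so the
trivial equilibrium is globally asymptotically stable below the critical parameter. -/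
theorem normal_form_subcritical_stability
    (α β : ℝ) (hα : 0 ≤ α)
    (f : ℝ → EuclideanSpace ℝ (Fin 2))
    (hf : ∀ t : ℝ, 0 ≤ t → HasDerivAt f (β • f t - (α * ‖f t‖ ^ 2) • f t) t) :
    (∀ t : ℝ, 0 ≤ t → ‖f t‖ ≤ Real.exp (β * t) * ‖f 0‖) ∧
    (β < 0 → Tendsto f atTop (nhds 0)) := by
  have hbound (t : ℝ) (ht : 0 ≤ t) : ‖f t‖ ≤ Real.exp (β * t) * ‖f 0‖ := by
    refine norm_le_exp_mul_norm_of_inner_deriv_le (fun s hs ↦ (hf s hs).hasDerivWithinAt)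
      (fun s _ ↦ ?_) ht
    rw [inner_sub_right, inner_smul_right, inner_smul_right, real_inner_self_eq_norm_sq]
    exact sub_le_self _ (by positivity)
  refine ⟨hbound, fun hβ ↦ squeeze_zero_norm' ((eventually_ge_atTop 0).mono hbound) ?_⟩
  simpa using (Real.tendsto_exp_atBot.comp
    (tendsto_id.const_mul_atTop_of_neg hβ)).mul_const ‖f 0‖
end
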